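/- Let q ≥ 3 be a prime number, A a subset of {0,1,...,q-1} with 1 < #A < q, and let K(q,A) = { Σ_{i=1}^∞ d_i/q^i : d_i ∈ A for all i ∈ ℕ }. Let p ≥ 2 be an integer and let B_p be the topological closure of { p^{-k} : k ∈ ℕ } in ℝ. If (log p)/(log q) is irrational, then B_p ∩ K(q,A) is a finite set. -/

import Mathlib

/-- `K q A` is the set of reals `∑_{i=1}^∞ d_i / q^i` with all digits `d_i ∈ A`. -/
def K (q : ℕ) (A : Finset ℕ) : Set ℝ :=
  {x | ∃ d : ℕ → ℕ, (∀ i, d i ∈ A) ∧ x = ∑' i : ℕ, (d i : ℝ) / (q : ℝ) ^ (i + 1)}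

/-- `B p` is the topological closure in `ℝ` of `{p^{-k} : k ∈ ℕ, k ≥ 1}`. -/
def B (p : ℕ) : Set ℝ :=
  closure {x : ℝ | ∃ k : ℕ, 0 < k ∧ x = ((p : ℝ) ^ k)⁻¹}

open Filter Topology

lemma exists_one_add_pow_eq_cubic (x : ℤ) (n : ℕ) :
    ∃ C R : ℤ, 2 * C = n * (n - 1) ∧ (1 + x) ^ n = 1 + n * x + C * x ^ 2 + x ^ 3 * R := by
  induction n with
  | zero => exact ⟨0, 0, by simp, by simp⟩
  | succ n ih =>
    obtain ⟨C, R, hC, hR⟩ := ih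
    refine ⟨C + n, C + R + x * R, ?_, ?_⟩
    · push_cast; linear_combination hC
    · rw [pow_succ, hR]; push_cast; ring

lemma exists_one_add_pow_eq_quadratic (x : ℤ) (n : ℕ) :
    ∃ R : ℤ, (1 + x) ^ n = 1 + n * x + x ^ 2 * R := by
  obtain ⟨C, R, -, h⟩ := exists_one_add_pow_eq_cubic x n
  exact ⟨C + x * R, by rw [h]; ring⟩

lemma exists_one_add_pow_pow_eq (m : ℕ) (z : ℤ) (t : ℕ) :
    ∃ u : ℤ, (1 + 2 * m * z) ^ m ^ t = 1 + 2 * m * z * m ^ t * (1 + m * u) := by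
  induction t with
  | zero => exact ⟨0, by simp⟩
  | succ t ih =>
    obtain ⟨u, hu⟩ := ih
    obtain ⟨C, R, hC, hR⟩ :=
      exists_one_add_pow_eq_cubic (2 * m * z * m ^ t * (1 + m * u)) m
    set y : ℤ := z * m ^ t * (1 + m * u) with hy
    refine ⟨u + (1 + m * u) * ((m - 1) * y + 4 * y ^ 2 * R), ?_⟩
    have hx : 2 * (m : ℤ) * z * m ^ t * (1 + m * u) = 2 * m * y := by rw [hy]; ring
    rw [pow_succ, pow_mul, hu, hR, hx]
    have key : 1 + (m : ℤ) * (2 * m * y) + C * (2 * m * y) ^ 2 + (2 * m * y) ^ 3 * R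
        = 1 + m * (2 * m * y) * (1 + m * ((m - 1) * y + 4 * y ^ 2 * R)) := by
      linear_combination (2 * m ^ 2 * y ^ 2) * hC
    rw [key]
    generalize (m - 1) * y + 4 * y ^ 2 * R = w
    rw [hy]
    ring

/-- The powers of `1 + c`, where `2 * m ∣ c`, represent every residue class
congruent to `1` modulo `c`, to the modulus `c * m ^ t`. -/
lemma exists_pow_eq_one_add_mul (m : ℕ) (hm : 0 < m) (z y : ℤ) (t : ℕ) :
    ∃ (j : ℕ) (s : ℤ), (1 + 2 * m * z) ^ j = 1 + 2 * m * z * y + 2 * m * z * m ^ t * s := by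
  induction t with
  | zero => exact ⟨0, -y, by simp⟩
  | succ t ih =>
    obtain ⟨j, s, hj⟩ := ih
    obtain ⟨u, hu⟩ := exists_one_add_pow_pow_eq m z t
    obtain ⟨l, g, hl⟩ : ∃ (l : ℕ) (g : ℤ), (s : ℤ) + l = m * g := by
      have hm' : (0 : ℤ) < m := by exact_mod_cast hm
      obtain ⟨l, hl⟩ := Int.eq_ofNat_of_zero_le (Int.emod_nonneg (-s) hm'.ne')
      refine ⟨l, -(-s / m), ?_⟩
      have := Int.emod_add_mul_ediv (-s) m
      rw [hl] at this
      linear_combination this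
    obtain ⟨R, hR⟩ := exists_one_add_pow_eq_quadratic (2 * m * z * m ^ t * (1 + m * u)) l
    refine ⟨j + m ^ t * l, g + l * u + 2 * z * m ^ t * (1 + m * u) ^ 2 * R +
      (2 * z * y + 2 * z * m ^ t * s) *
        (l * (1 + m * u) + 2 * m * z * m ^ t * (1 + m * u) ^ 2 * R), ?_⟩
    rw [pow_add, pow_mul, hu, hR, hj]
    linear_combination (2 * m * z * m ^ t) * hl

lemma summable_digits {q : ℕ} (hq : 2 ≤ q) {d : ℕ → ℕ} (hd : ∀ i, d i < q) :
    Summable fun i : ℕ => (d i : ℝ) / (q : ℝ) ^ (i + 1) := by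
  have hq0 : (0 : ℝ) < q := by positivity
  have hq1 : (q : ℝ)⁻¹ < 1 := inv_lt_one_of_one_lt₀ (by exact_mod_cast hq)
  refine Summable.of_nonneg_of_le (fun i => by positivity) (fun i => ?_)
    (summable_geometric_of_lt_one (by positivity) hq1)
  have : (d i : ℝ) ≤ q := by exact_mod_cast (hd i).le
  rw [inv_pow, pow_succ, div_le_iff₀ (by positivity)]
  field_simp
  exact this

lemma K_subset_Icc {q : ℕ} (hq : 2 ≤ q) {A : Finset ℕ} (hA : A ⊆ Finset.range q) :
    K q A ⊆ Set.Icc 0 1 := by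
  rintro x ⟨d, hd, rfl⟩
  have hdq : ∀ i, d i < q := fun i => Finset.mem_range.1 (hA (hd i))
  have hq0 : (0 : ℝ) < q := by positivity
  have hq1 : (q : ℝ)⁻¹ < 1 := inv_lt_one_of_one_lt₀ (by exact_mod_cast hq)
  refine ⟨tsum_nonneg fun i => by positivity, ?_⟩
  have hg := (hasSum_geometric_of_lt_one (by positivity) hq1).mul_left (((q : ℝ) - 1) / q)
  have h1 : ((q : ℝ) - 1) / q * (1 - (q : ℝ)⁻¹)⁻¹ = 1 := by
    have : (q : ℝ) - 1 ≠ 0 := by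
      have : (1 : ℝ) < q := by exact_mod_cast hq
      linarith
    have h2 : 1 - (q : ℝ)⁻¹ = ((q : ℝ) - 1) / q := by field_simp
    rw [h2, mul_inv_cancel₀ (by positivity)]
  rw [h1] at hg
  rw [← hg.tsum_eq]
  refine (summable_digits hq hdq).tsum_le_tsum (fun i => ?_) hg.summable
  have : (d i : ℝ) ≤ q - 1 := by
    have : (d i : ℝ) + 1 ≤ q := by exact_mod_cast hdq i
    linarith
  rw [inv_pow, pow_succ, div_mul_eq_mul_div, ← div_eq_mul_inv, div_div]
  gcongr

lemma exists_digit_of_mem_K {q : ℕ} (hq : 2 ≤ q) {A : Finset ℕ} (hA : A ⊆ Finset.range q)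
    {x : ℝ} (hx : x ∈ K q A) : ∃ a ∈ A, (q : ℝ) * x - a ∈ K q A := by
  obtain ⟨d, hd, rfl⟩ := hx
  have hdq : ∀ i, d i < q := fun i => Finset.mem_range.1 (hA (hd i))
  have hq0 : (q : ℝ) ≠ 0 := by positivity
  refine ⟨d 0, hd 0, fun i => d (i + 1), fun i => hd _, ?_⟩
  rw [(summable_digits hq hdq).tsum_eq_zero_add, mul_add, ← tsum_mul_left]
  have h : ∀ i : ℕ, (q : ℝ) * ((d (i + 1) : ℝ) / (q : ℝ) ^ (i + 1 + 1)) =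
      (d (i + 1) : ℝ) / (q : ℝ) ^ (i + 1) := by
    intro i
    rw [pow_succ (q : ℝ) (i + 1)]
    field_simp
  simp only [h]
  field_simp
  ring

lemma exists_pow_mul_sub_mem_K {q : ℕ} (hq : 2 ≤ q) {A : Finset ℕ} (hA : A ⊆ Finset.range q)
    {x : ℝ} (hx : x ∈ K q A) (n : ℕ) : ∃ z : ℤ, (q : ℝ) ^ n * x - z ∈ K q A := by
  induction n with
  | zero => exact ⟨0, by simpa using hx⟩
  | succ n ih =>
    obtain ⟨z, hz⟩ := ih
    obtain ⟨a, -, ha⟩ := exists_digit_of_mem_K hq hA hz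
    refine ⟨q * z + a, ?_⟩
    convert ha using 1
    push_cast
    ring

/-- `K q A` avoids the open `q`-adic interval of every missing digit. -/
lemma notMem_K_of_mem_Ioo {q : ℕ} (hq : 2 ≤ q) {A : Finset ℕ} (hA : A ⊆ Finset.range q)
    {a : ℕ} (ha : a ∉ A) {x : ℝ} (h1 : (a : ℝ) < q * x) (h2 : q * x < a + 1) :
    x ∉ K q A := by
  intro hx
  obtain ⟨b, hb, hbK⟩ := exists_digit_of_mem_K hq hA hx
  obtain ⟨h3, h4⟩ := K_subset_Icc hq hA hbK
  have h5 : a < b + 1 := by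
    have : (a : ℝ) < b + 1 := by linarith
    exact_mod_cast this
  have h6 : b < a + 1 := by
    have : (b : ℝ) < a + 1 := by linarith
    exact_mod_cast this
  obtain rfl : a = b := by omega
  exact ha hb

lemma B_subset {p : ℕ} (hp : 2 ≤ p) :
    B p ⊆ insert 0 (Set.range fun k : ℕ => ((p : ℝ) ^ k)⁻¹) := by
  have hlim : Tendsto (fun k : ℕ => ((p : ℝ) ^ k)⁻¹) atTop (𝓝 0) :=
    (tendsto_pow_atTop_atTop_of_one_lt (by exact_mod_cast hp)).inv_tendsto_atTop
  refine closure_minimal ?_ hlim.isCompact_insert_range.isClosed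
  rintro x ⟨k, -, rfl⟩
  exact Or.inr ⟨k, rfl⟩

/-- Some power of `q` divided by `m ^ k` has fractional part in the interval of the digit `a`. -/
lemma exists_pow_eq_add_mul_pow {q m : ℕ} (hq : 2 ≤ q) (hm : 2 ≤ m)
    (hqm : q.Coprime (2 * m)) : ∃ N : ℕ, ∀ k ≥ N, ∀ a : ℕ, ∃ (n r : ℕ) (w : ℤ),
      (q : ℤ) ^ n = r + m ^ k * w ∧ a * m ^ k < q * r ∧ q * r < (a + 1) * m ^ k := by
  have hM : 0 < Nat.totient (2 * m) := Nat.totient_pos.2 (by omega)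
  have hQ : 1 < q ^ Nat.totient (2 * m) := Nat.one_lt_pow hM.ne' (by omega)
  obtain ⟨z, hz⟩ := (Nat.modEq_iff_dvd' hQ.le).1 (Nat.ModEq.pow_totient hqm).symm
  set c := 2 * m * z with hc
  have hcpos : 0 < c := by omega
  have hQc : q ^ Nat.totient (2 * m) = 1 + c := by omega
  refine ⟨q * c + q, fun k hk a => ?_⟩
  have hmk : q * c + q < m ^ k := hk.trans_lt (Nat.lt_pow_self (by omega))
  have hqc : 0 < q * c := by positivity
  obtain ⟨j, s, hj⟩ := exists_pow_eq_one_add_mul m (by omega) z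
    ((a * m ^ k / (q * c) + 1 : ℕ) : ℤ) k
  refine ⟨Nat.totient (2 * m) * j, 1 + c * (a * m ^ k / (q * c) + 1), 2 * m * z * s, ?_, ?_, ?_⟩
  · have hQ' : (q : ℤ) ^ Nat.totient (2 * m) = 1 + 2 * m * z := by exact_mod_cast hQc
    rw [pow_mul, hQ', hj, hc]
    push_cast
    ring
  · have := Nat.lt_mul_div_succ (a * m ^ k) hqc
    nlinarith
  · have := Nat.mul_div_le (a * m ^ k) (q * c)
    nlinarith

theorem stmt_16 (q : ℕ) (hq : 3 ≤ q) (hqp : q.Prime)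
    (A : Finset ℕ) (hAq : A ⊆ Finset.range q) (hA1 : 1 < A.card) (hA2 : A.card < q)
    (p : ℕ) (hp : 2 ≤ p)
    (hirr : Irrational (Real.log p / Real.log q)) :
    (B p ∩ K q A).Finite := by
  have hq2 : 2 ≤ q := by omega
  obtain ⟨e, m, hqm, hpe⟩ := Nat.exists_eq_pow_mul_and_not_dvd (n := p) (by omega) q hqp.ne_one
  have hm : 2 ≤ m := by
    have h0 : m ≠ 0 := by rintro rfl; simp at hqm
    have h1 : m ≠ 1 := by
      rintro rfl
      have hlog : Real.log q ≠ 0 := (Real.log_pos (by exact_mod_cast hqp.one_lt)).ne'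
      refine hirr ⟨e, ?_⟩
      rw [hpe]
      push_cast
      rw [mul_one, Real.log_pow]
      field_simp
    omega
  have hcop : q.Coprime (2 * m) := by
    refine Nat.Coprime.mul_right ?_ ((Nat.Prime.coprime_iff_not_dvd hqp).2 hqm)
    exact (Nat.coprime_primes hqp Nat.prime_two).2 (by omega)
  obtain ⟨a, haq, haA⟩ : ∃ a ∈ Finset.range q, a ∉ A :=
    Finset.exists_mem_notMem_of_card_lt_card (by simpa using hA2)
  obtain ⟨N, hN⟩ := exists_pow_eq_add_mul_pow hq2 hm hcop
  refine (((Set.finite_Iio N).image fun k : ℕ => ((p : ℝ) ^ k)⁻¹).insert 0).subset ?_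
  rintro x ⟨hxB, hxK⟩
  rcases B_subset hp hxB with rfl | ⟨k, rfl⟩
  · exact Or.inl rfl
  refine Or.inr ⟨k, ?_, rfl⟩
  rw [Set.mem_Iio]
  by_contra! hk
  obtain ⟨n, r, w, hnr, h1, h2⟩ := hN k hk a
  obtain ⟨z, hz⟩ := exists_pow_mul_sub_mem_K hq2 hAq hxK (e * k + n)
  have hmk : (0 : ℝ) < (m : ℝ) ^ k := by positivity
  have hq0 : (0 : ℝ) < q := by positivity
  have hx : (q : ℝ) ^ (e * k + n) * ((p : ℝ) ^ k)⁻¹ = r / m ^ k + w := by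
    have hnr' : (q : ℝ) ^ n = r + m ^ k * w := by exact_mod_cast hnr
    rw [hpe, pow_add, hnr', pow_mul]
    push_cast
    rw [mul_pow]
    field_simp
  simp only [hx] at hz
  have h1' : (a : ℝ) < q * (r / m ^ k) := by
    rw [← mul_div_assoc, lt_div_iff₀ hmk]; exact_mod_cast h1
  have h2' : (q : ℝ) * (r / m ^ k) < a + 1 := by
    rw [← mul_div_assoc, div_lt_iff₀ hmk]; exact_mod_cast h2
  have haq' : (a : ℝ) + 1 ≤ q := by exact_mod_cast Finset.mem_range.1 haq
  have hu0 : (0 : ℝ) < r / m ^ k := pos_of_mul_pos_right ((Nat.cast_nonneg a).trans_lt h1') hq0.le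
  have hu1 : (r : ℝ) / m ^ k < 1 := by
    by_contra! h
    nlinarith
  obtain ⟨h3, h4⟩ := K_subset_Icc hq2 hAq hz
  have hwz : w = z := by
    have h5 : w < z + 1 := by
      have : (w : ℝ) < z + 1 := by linarith
      exact_mod_cast this
    have h6 : z < w + 1 := by
      have : (z : ℝ) < w + 1 := by linarith
      exact_mod_cast this
    omega
  rw [hwz, add_sub_cancel_right] at hz
  exact notMem_K_of_mem_Ioo hq2 hAq haA h1' h2' hz
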